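/- Every 3-quasi-Sasakian manifold of rank 4l+1 (equivalently, with c = 0, i.e. whose Reeb vector fields pairwise commute) is 3-cosymplectic. -/

import Mathlib

/-!
An abstract (Lie–Rinehart style) algebraic model of the differential geometry of
almost contact metric 3-structures: `F` plays the role of the algebra of smooth
functions on a manifold `M` of dimension `4n+3`, and `V` plays the role of the
`F`-module of smooth vector fields, acting on `F` by derivations and carrying a
Lie bracket, a Riemannian metric `g`, and three almost contact metric structures
`(φ_α, ξ_α, η_α, g)`.
-/

noncomputable section

namespace QS3

/-- Cyclic (= even) permutations of `{0,1,2}`, modelling even permutations of `{1,2,3}`. -/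
def Cyclic (a b c : Fin 3) : Prop :=
  (a, b, c) = (0, 1, 2) ∨ (a, b, c) = (1, 2, 0) ∨ (a, b, c) = (2, 0, 1)

/-- The algebraic model of the smooth structure of a manifold: an `ℝ`-algebra `F`
of smooth functions and an `F`-module `V` of vector fields acting on `F` by
derivations and carrying the Lie bracket of vector fields. -/
class SmoothSetting (F : Type) (V : Type) [CommRing F] [Algebra ℝ F]
    [AddCommGroup V] [Module F V] where
  act : V → F → F
  bracket : V → V → V
  act_add : ∀ (X : V) (f₁ f₂ : F), act X (f₁ + f₂) = act X f₁ + act X f₂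
  act_mul : ∀ (X : V) (f₁ f₂ : F), act X (f₁ * f₂) = act X f₁ * f₂ + f₁ * act X f₂
  act_const : ∀ (X : V) (r : ℝ), act X (algebraMap ℝ F r) = 0
  act_addLeft : ∀ (X Y : V) (f : F), act (X + Y) f = act X f + act Y f
  act_smulLeft : ∀ (f : F) (X : V) (h : F), act (f • X) h = f * act X h
  bracket_antisymm : ∀ X Y : V, bracket X Y = -bracket Y X
  bracket_addLeft : ∀ X Y Z : V, bracket (X + Y) Z = bracket X Z + bracket Y Z
  bracket_act : ∀ (X Y : V) (f : F),
    act (bracket X Y) f = act X (act Y f) - act Y (act X f)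
  bracket_smulRight : ∀ (X : V) (f : F) (Y : V),
    bracket X (f • Y) = f • bracket X Y + act X f • Y
  jacobi : ∀ X Y Z : V,
    bracket X (bracket Y Z) + bracket Y (bracket Z X) + bracket Z (bracket X Y) = 0

section d

variable (F V : Type) [CommRing F] [Algebra ℝ F] [AddCommGroup V] [Module F V]
  [SmoothSetting F V]

/-- The action of a vector field on a function (directional derivative). -/
def der (X : V) (f : F) : F := SmoothSetting.act X f

/-- The Lie bracket of vector fields. -/
def lie (X Y : V) : V := SmoothSetting.bracket F X Y

/-- Exterior differential of a 1-form (with the `1/2` normalization convention,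
so that `2 dθ(X,Y) = X θ(Y) - Y θ(X) - θ([X,Y])`). -/
def dOne (θ : V → F) (X Y : V) : F :=
  (2 : ℝ)⁻¹ • (der F V X (θ Y) - der F V Y (θ X) - θ (lie F V X Y))

/-- Exterior differential of a 2-form (with the `1/3` normalization convention). -/
def dTwo (ω : V → V → F) (X Y Z : V) : F :=
  (3 : ℝ)⁻¹ • (der F V X (ω Y Z) + der F V Y (ω Z X) + der F V Z (ω X Y)
    - ω (lie F V X Y) Z - ω (lie F V Y Z) X - ω (lie F V Z X) Y)

end d

/-- An almost contact metric 3-structure on a manifold of dimension `4n+3`: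
three almost contact metric structures `(φ_α, ξ_α, η_α, g)` satisfying the
quaternionic-type relations, together with a (local) orthonormal frame. -/
class ACM3 (F V : Type) [CommRing F] [Algebra ℝ F] [AddCommGroup V] [Module F V]
    [SmoothSetting F V] where
  n : ℕ
  g : V → V → F
  phi : Fin 3 → V → V
  xi : Fin 3 → V
  eta : Fin 3 → V → F
  g_symm : ∀ X Y, g X Y = g Y X
  g_addLeft : ∀ X Y Z, g (X + Y) Z = g X Z + g Y Z
  g_smulLeft : ∀ (f : F) (X Y : V), g (f • X) Y = f * g X Y
  g_nondeg : ∀ X, (∀ Y, g X Y = 0) → X = 0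
  phi_add : ∀ α (X Y : V), phi α (X + Y) = phi α X + phi α Y
  phi_smul : ∀ α (f : F) (X : V), phi α (f • X) = f • phi α X
  eta_eq : ∀ α X, eta α X = g X (xi α)
  acm_sq : ∀ α X, phi α (phi α X) = -X + eta α X • xi α
  eta_xi : ∀ α, eta α (xi α) = 1
  compat : ∀ α X Y, g (phi α X) (phi α Y) = g X Y - eta α X * eta α Y
  quat_phi : ∀ a b c, Cyclic a b c → ∀ X, phi c X = phi a (phi b X) - eta b X • xi a
  quat_phi' : ∀ a b c, Cyclic a b c → ∀ X, phi c X = -(phi b (phi a X)) + eta a X • xi b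
  quat_xi : ∀ a b c, Cyclic a b c → xi c = phi a (xi b)
  quat_xi' : ∀ a b c, Cyclic a b c → xi c = -(phi b (xi a))
  quat_eta : ∀ a b c, Cyclic a b c → ∀ X, eta c X = eta a (phi b X)
  quat_eta' : ∀ a b c, Cyclic a b c → ∀ X, eta c X = -(eta b (phi a X))
  frame : Fin (4 * n + 3) → V
  frame_orth : ∀ i j, g (frame i) (frame j) = if i = j then 1 else 0
  frame_span : ∀ X : V, X = ∑ i, g X (frame i) • frame i

section acm

variable (F V : Type) [CommRing F] [Algebra ℝ F] [AddCommGroup V] [Module F V]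
  [SmoothSetting F V] [ACM3 F V]

/-- The integer `n` (the manifold has dimension `4n+3`). -/
def dimn : ℕ := ACM3.n F V

/-- The Riemannian metric. -/
def gm (X Y : V) : F := ACM3.g X Y

/-- The structure tensors `φ_α`. -/
def ph (α : Fin 3) (X : V) : V := ACM3.phi F α X

/-- The Reeb vector fields `ξ_α`. -/
def rxi (α : Fin 3) : V := ACM3.xi F α

/-- The 1-forms `η_α`. -/
def et (α : Fin 3) (X : V) : F := ACM3.eta α X

/-- The orthonormal frame. -/
def fr (i : Fin (4 * dimn F V + 3)) : V := ACM3.frame i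

/-- The fundamental 2-form `Φ_α(X,Y) = g(X, φ_α Y)`. -/
def Phi (α : Fin 3) (X Y : V) : F := gm F V X (ph F V α Y)

/-- The Nijenhuis torsion `[φ_α, φ_α]` of `φ_α`. -/
def Nij (α : Fin 3) (X Y : V) : V :=
  ph F V α (ph F V α (lie F V X Y)) + lie F V (ph F V α X) (ph F V α Y)
    - ph F V α (lie F V (ph F V α X) Y) - ph F V α (lie F V X (ph F V α Y))

/-- The normality tensor `N⁽¹⁾_α = [φ_α, φ_α] + 2 dη_α ⊗ ξ_α`. -/
def NOne (α : Fin 3) (X Y : V) : V :=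
  Nij F V α X Y + ((2 : ℝ) • dOne F V (et F V α) X Y) • rxi F V α

/-- The structure `(φ_α, ξ_α, η_α)` is normal. -/
def IsNormal (α : Fin 3) : Prop := ∀ X Y, NOne F V α X Y = 0

/-- A 2-form is closed. -/
def IsClosedTwo (ω : V → V → F) : Prop := ∀ X Y Z, dTwo F V ω X Y Z = 0

/-- The structure `(φ_α, ξ_α, η_α, g)` is quasi-Sasakian: normal with closed
fundamental 2-form. -/
def IsQuasiSasakian (α : Fin 3) : Prop :=
  IsNormal F V α ∧ IsClosedTwo F V (Phi F V α)

/-- `M` is 3-cosymplectic: each structure is normal with `dη_α = 0` and `dΦ_α = 0`. -/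
def ThreeCosymplectic : Prop :=
  ∀ α, IsNormal F V α ∧ (∀ X Y, dOne F V (et F V α) X Y = 0) ∧
    IsClosedTwo F V (Phi F V α)

/-- `M` is 3-α-Sasakian with constant `a ≠ 0`: each structure is normal (an
`α`-Sasakian structure) and `dη_δ = a Φ_δ`. -/
def Is3AlphaSasakianWith (a : ℝ) : Prop :=
  a ≠ 0 ∧ (∀ δ, IsNormal F V δ) ∧
    ∀ (δ : Fin 3) (X Y : V), dOne F V (et F V δ) X Y = algebraMap ℝ F a * Phi F V δ X Y

/-- A vector field is horizontal: it lies in `H = ∩_α ker η_α`. -/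
def Horiz (X : V) : Prop := ∀ α, et F V α X = 0

/-- A vector field is vertical: it lies in `V = ⟨ξ₁, ξ₂, ξ₃⟩`. -/
def InVert (X : V) : Prop :=
  ∃ p q r : F, X = p • rxi F V 0 + q • rxi F V 1 + r • rxi F V 2

/-- The distribution `E^{4m} = {X ∈ H : i_X dη_α = 0}`. -/
def InE4m (X : V) : Prop :=
  Horiz F V X ∧ ∀ (α : Fin 3) (Y : V), dOne F V (et F V α) X Y = 0

/-- The distribution `E^{4l}`: the orthogonal complement of `E^{4m}` in `H`. -/
def InE4l (X : V) : Prop :=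
  Horiz F V X ∧ ∀ Y, InE4m F V Y → gm F V X Y = 0

/-- The distribution `E^{4l+3} = E^{4l} ⊕ V`. -/
def InE4l3 (X : V) : Prop :=
  ∃ Y Z, InE4l F V Y ∧ InVert F V Z ∧ X = Y + Z

/-- The distribution `E^{4m+3} = E^{4m} ⊕ V`. -/
def InE4m3 (X : V) : Prop :=
  ∃ Y Z, InE4m F V Y ∧ InVert F V Z ∧ X = Y + Z

/-- The horizontal component `X_H = X - ∑_α η_α(X) ξ_α` of a vector field. -/
def horComp (X : V) : V := X - ∑ α : Fin 3, et F V α X • rxi F V α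

/-- A vector field is basic with respect to the foliation defined by `E^{4m}`. -/
def BasicE4m (X : V) : Prop :=
  InE4l3 F V X ∧ ∀ W, InE4m F V W → InE4m F V (lie F V W X)

/-- A vector field is basic with respect to the foliation defined by `E^{4l+3}`. -/
def BasicE4l3 (X : V) : Prop :=
  InE4m F V X ∧ ∀ W, InE4l3 F V W → InE4l3 F V (lie F V W X)

end acm

/-- A 3-quasi-Sasakian structure: each of the three almost contact metric
structures is quasi-Sasakian.  We also record, as part of the structure, the
standard structural facts established for such manifolds in the literature
(Cappelletti Montano–De Nicola–Dileo): the Reeb commutation relations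
`[ξ_α, ξ_β] = c ξ_γ`, the splitting `H = E^{4l} ⊕ E^{4m}` (constancy of the
rank), the `φ_α`-invariance of both distributions, and the tensors `ψ_α`
(equal to `φ_α` on `E^{4l+3}` and vanishing on `E^{4m}` when the rank is
`4l+3`, i.e. `c ≠ 0`; equal to `φ_α` on `E^{4l}` and vanishing on `E^{4m+3}`
when the rank is `4l+1`, i.e. `c = 0`). -/
class ThreeQS (F V : Type) [CommRing F] [Algebra ℝ F] [AddCommGroup V] [Module F V]
    [SmoothSetting F V] [ACM3 F V] where
  qs : ∀ α, IsQuasiSasakian F V α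
  c : ℝ
  reeb_bracket : ∀ a b c', Cyclic a b c' →
    lie F V (rxi F V a) (rxi F V b) = algebraMap ℝ F c • rxi F V c'
  horiz_split : ∀ X, Horiz F V X → ∃ Y Z, InE4l F V Y ∧ InE4m F V Z ∧ X = Y + Z
  phi_E4l : ∀ α X, InE4l F V X → InE4l F V (ph F V α X)
  phi_E4m : ∀ α X, InE4m F V X → InE4m F V (ph F V α X)
  psi : Fin 3 → V → V
  psi_add : ∀ α (X Y : V), psi α (X + Y) = psi α X + psi α Y
  psi_smul : ∀ α (f : F) (X : V), psi α (f • X) = f • psi α X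
  psi_E4l : ∀ α X, InE4l F V X → psi α X = ph F V α X
  psi_E4m : ∀ α X, InE4m F V X → psi α X = 0
  psi_vert_of_ne : c ≠ 0 → ∀ α β, psi α (rxi F V β) = ph F V α (rxi F V β)
  psi_vert_of_eq : c = 0 → ∀ α β, psi α (rxi F V β) = 0

section tqs

variable (F V : Type) [CommRing F] [Algebra ℝ F] [AddCommGroup V] [Module F V]
  [SmoothSetting F V] [ACM3 F V] [ThreeQS F V]

/-- The constant `c` with `[ξ_α, ξ_β] = c ξ_γ`. -/
def cc : ℝ := ThreeQS.c F V

/-- The tensors `ψ_α`. -/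
def psiT (α : Fin 3) (X : V) : V := ThreeQS.psi F α X

/-- The tensors `θ_α = φ_α - ψ_α`. -/
def thetaT (α : Fin 3) (X : V) : V := ph F V α X - psiT F V α X

/-- The 2-forms `Θ_α(X,Y) = g(X, θ_α Y)`. -/
def ThetaForm (α : Fin 3) (X Y : V) : F := gm F V X (thetaT F V α Y)

end tqs

/-- The 3-quasi-Sasakian manifold has rank `4l+3`: the constant `c` is nonzero
and the orthonormal frame is adapted to the splitting
`TM = E^{4l} ⊕ E^{4m} ⊕ ⟨ξ₁,ξ₂,ξ₃⟩` with `dim E^{4l} = 4l` (hence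
`dim E^{4m} = 4m`, `m = n - l`, and the rank of the `η_α` is `4l+3`). -/
class HasRank (F V : Type) [CommRing F] [Algebra ℝ F] [AddCommGroup V] [Module F V]
    [SmoothSetting F V] [ACM3 F V] [ThreeQS F V] (l : ℕ) : Prop where
  c_ne : cc F V ≠ 0
  l_le : l ≤ dimn F V
  frame_E4l : ∀ i : Fin (4 * dimn F V + 3), i.val < 4 * l → InE4l F V (fr F V i)
  frame_E4m : ∀ i : Fin (4 * dimn F V + 3), 4 * l ≤ i.val → i.val < 4 * dimn F V →
    InE4m F V (fr F V i)
  frame_xi : ∀ (i : Fin (4 * dimn F V + 3)) (a : Fin 3),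
    i.val = 4 * dimn F V + a.val → fr F V i = rxi F V a

/-- The Levi-Civita connection of `g`: the unique torsion-free metric connection. -/
class LeviCivita (F V : Type) [CommRing F] [Algebra ℝ F] [AddCommGroup V] [Module F V]
    [SmoothSetting F V] [ACM3 F V] where
  nabla : V → V → V
  nabla_addLeft : ∀ X Y Z : V, nabla (X + Y) Z = nabla X Z + nabla Y Z
  nabla_smulLeft : ∀ (f : F) (X Y : V), nabla (f • X) Y = f • nabla X Y
  nabla_addRight : ∀ X Y Z : V, nabla X (Y + Z) = nabla X Y + nabla X Z
  nabla_leibniz : ∀ (X : V) (f : F) (Y : V),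
    nabla X (f • Y) = der F V X f • Y + f • nabla X Y
  nabla_metric : ∀ X Y Z : V,
    der F V X (gm F V Y Z) = gm F V (nabla X Y) Z + gm F V Y (nabla X Z)
  nabla_torsionFree : ∀ X Y : V, nabla X Y - nabla Y X = lie F V X Y

section curv

variable (F V : Type) [CommRing F] [Algebra ℝ F] [AddCommGroup V] [Module F V]
  [SmoothSetting F V] [ACM3 F V] [LeviCivita F V]

/-- The Levi-Civita covariant derivative `∇_X Y`. -/
def nab (X Y : V) : V := LeviCivita.nabla F X Y

/-- The Riemannian curvature `R(X,Y)Z = ∇_X ∇_Y Z - ∇_Y ∇_X Z - ∇_{[X,Y]} Z`. -/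
def Rcurv (X Y Z : V) : V :=
  nab F V X (nab F V Y Z) - nab F V Y (nab F V X Z) - nab F V (lie F V X Y) Z

/-- The Ricci tensor `Ric(X,Y) = ∑_i g(R(e_i, X)Y, e_i)`. -/
def Ric (X Y : V) : F :=
  ∑ i, gm F V (Rcurv F V (fr F V i) X Y) (fr F V i)

/-- The scalar curvature. -/
def Scal : F := ∑ i, Ric F V (fr F V i) (fr F V i)

/-- `M` is Einstein: `Ric = a g` for a constant `a`. -/
def Einstein : Prop :=
  ∃ a : ℝ, ∀ X Y, Ric F V X Y = algebraMap ℝ F a * gm F V X Y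

/-- `M` is η-Einstein: `Ric = a g + b ∑_α η_α ⊗ η_α` for constants `a, b`. -/
def EtaEinstein : Prop :=
  ∃ a b : ℝ, ∀ X Y, Ric F V X Y
    = algebraMap ℝ F a * gm F V X Y
      + algebraMap ℝ F b * ∑ α : Fin 3, et F V α X * et F V α Y

end curv

/-- A (Koszul) linear connection on vector fields. -/
def IsConnection (F V : Type) [CommRing F] [Algebra ℝ F] [AddCommGroup V] [Module F V]
    [SmoothSetting F V] (D : V → V → V) : Prop :=
  (∀ X Y Z : V, D (X + Y) Z = D X Z + D Y Z) ∧
  (∀ (f : F) (X Y : V), D (f • X) Y = f • D X Y) ∧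
  (∀ X Y Z : V, D X (Y + Z) = D X Y + D X Z) ∧
  (∀ (X : V) (f : F) (Y : V), D X (f • Y) = der F V X f • Y + f • D X Y)

end QS3

namespace QS3

lemma eq_zero_of_add_self_eq_zero (F : Type) {V : Type} [CommRing F] [Algebra ℝ F]
    [AddCommGroup V] [Module F V] {X : V} (h : X + X = 0) : X = 0 := by
  have h2 : algebraMap ℝ F 2 • X = 0 := by
    rw [map_ofNat, ofNat_smul_eq_nsmul F 2 X, two_nsmul, h]
  have h3 := congrArg (fun Y => algebraMap ℝ F 2⁻¹ • Y) h2
  rw [smul_smul, ← map_mul, inv_mul_cancel₀ two_ne_zero, map_one, one_smul, smul_zero] at h3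
  exact h3

section lemmas

variable (F V : Type) [CommRing F] [Algebra ℝ F] [AddCommGroup V] [Module F V]
  [SmoothSetting F V]

lemma der_zero (X : V) : der F V X 0 = 0 := by
  simpa [der] using SmoothSetting.act_const (F := F) X 0

lemma der_one (X : V) : der F V X 1 = 0 := by
  simpa [der] using SmoothSetting.act_const (F := F) X 1

lemma der_add (X : V) (f h : F) : der F V X (f + h) = der F V X f + der F V X h :=
  SmoothSetting.act_add X f h

lemma der_mul (X : V) (f h : F) :
    der F V X (f * h) = der F V X f * h + f * der F V X h :=
  SmoothSetting.act_mul X f h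

lemma der_neg (X : V) (f : F) : der F V X (-f) = -der F V X f := by
  refine eq_neg_of_add_eq_zero_left ?_
  rw [← der_add, neg_add_cancel, der_zero]

lemma der_sub (X : V) (f h : F) : der F V X (f - h) = der F V X f - der F V X h := by
  rw [sub_eq_add_neg, der_add, der_neg, sub_eq_add_neg]

lemma der_lie (X Y : V) (f : F) :
    der F V (lie F V X Y) f = der F V X (der F V Y f) - der F V Y (der F V X f) :=
  SmoothSetting.bracket_act X Y f

lemma lie_antisymm (X Y : V) : lie F V X Y = -lie F V Y X :=
  SmoothSetting.bracket_antisymm X Y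

lemma lie_add_left (X Y Z : V) : lie F V (X + Y) Z = lie F V X Z + lie F V Y Z :=
  SmoothSetting.bracket_addLeft X Y Z

lemma lie_add_right (X Y Z : V) : lie F V X (Y + Z) = lie F V X Y + lie F V X Z := by
  rw [lie_antisymm, lie_add_left, neg_add, ← lie_antisymm, ← lie_antisymm]

lemma lie_zero_right (X : V) : lie F V X 0 = 0 := by
  simpa using lie_add_right F V X 0 0

lemma lie_neg_right (X Y : V) : lie F V X (-Y) = -lie F V X Y := by
  refine eq_neg_of_add_eq_zero_left ?_
  rw [← lie_add_right, neg_add_cancel, lie_zero_right]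

lemma lie_sub_right (X Y Z : V) : lie F V X (Y - Z) = lie F V X Y - lie F V X Z := by
  rw [sub_eq_add_neg, lie_add_right, lie_neg_right, sub_eq_add_neg]

lemma lie_smul_right (X : V) (f : F) (Y : V) :
    lie F V X (f • Y) = f • lie F V X Y + der F V X f • Y :=
  SmoothSetting.bracket_smulRight X f Y

/-- The Jacobi identity in Leibniz form. -/
lemma lie_lie (X Y Z : V) :
    lie F V X (lie F V Y Z) = lie F V (lie F V X Y) Z + lie F V Y (lie F V X Z) := by
  have h := SmoothSetting.jacobi (F := F) X Y Z
  change lie F V X (lie F V Y Z) + lie F V Y (lie F V Z X) + lie F V Z (lie F V X Y) = 0 at h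
  rw [lie_antisymm F V Z X, lie_neg_right, lie_antisymm F V Z (lie F V X Y)] at h
  rw [← sub_eq_zero, ← h]
  abel

lemma lie_self (X : V) : lie F V X X = 0 :=
  eq_zero_of_add_self_eq_zero F (by nth_rw 1 [lie_antisymm]; simp)

/-- Unfolding of `2 dθ`. -/
lemma two_smul_dOne (θ : V → F) (X Y : V) :
    (2 : ℝ) • dOne F V θ X Y
      = der F V X (θ Y) - der F V Y (θ X) - θ (lie F V X Y) := by
  simp [dOne]

lemma dOne_eq_zero_iff (θ : V → F) (X Y : V) :
    dOne F V θ X Y = 0 ↔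
      der F V X (θ Y) - der F V Y (θ X) - θ (lie F V X Y) = 0 := by
  rw [← two_smul_dOne]
  simp

variable [ACM3 F V]

lemma gm_symm (X Y : V) : gm F V X Y = gm F V Y X := ACM3.g_symm X Y

lemma gm_add_left (X Y Z : V) : gm F V (X + Y) Z = gm F V X Z + gm F V Y Z :=
  ACM3.g_addLeft X Y Z

lemma gm_smul_left (f : F) (X Y : V) : gm F V (f • X) Y = f * gm F V X Y :=
  ACM3.g_smulLeft f X Y

lemma gm_add_right (X Y Z : V) : gm F V X (Y + Z) = gm F V X Y + gm F V X Z := by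
  rw [gm_symm, gm_add_left, gm_symm F V Y, gm_symm F V Z]

lemma gm_smul_right (f : F) (X Y : V) : gm F V X (f • Y) = f * gm F V X Y := by
  rw [gm_symm, gm_smul_left, gm_symm]

lemma gm_zero_right (X : V) : gm F V X 0 = 0 := by
  simpa using gm_add_right F V X 0 0

lemma gm_neg_right (X Y : V) : gm F V X (-Y) = -gm F V X Y := by
  refine eq_neg_of_add_eq_zero_left ?_
  rw [← gm_add_right, neg_add_cancel, gm_zero_right]

lemma gm_sub_right (X Y Z : V) : gm F V X (Y - Z) = gm F V X Y - gm F V X Z := by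
  rw [sub_eq_add_neg, gm_add_right, gm_neg_right, sub_eq_add_neg]

lemma gm_neg_left (X Y : V) : gm F V (-X) Y = -gm F V X Y := by
  rw [gm_symm, gm_neg_right, gm_symm]

variable {F V} in
lemma eq_of_gm_eq {X Y : V} (h : ∀ Z, gm F V Z X = gm F V Z Y) : X = Y := by
  refine sub_eq_zero.mp (ACM3.g_nondeg (F := F) _ fun Z => ?_)
  change gm F V (X - Y) Z = 0
  rw [gm_symm, gm_sub_right, h, sub_self]

lemma ph_add (a : Fin 3) (X Y : V) : ph F V a (X + Y) = ph F V a X + ph F V a Y :=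
  ACM3.phi_add a X Y

lemma ph_smul (a : Fin 3) (f : F) (X : V) : ph F V a (f • X) = f • ph F V a X :=
  ACM3.phi_smul a f X

lemma ph_zero (a : Fin 3) : ph F V a 0 = 0 := by
  simpa using ph_add F V a 0 0

lemma ph_neg (a : Fin 3) (X : V) : ph F V a (-X) = -ph F V a X := by
  refine eq_neg_of_add_eq_zero_left ?_
  rw [← ph_add, neg_add_cancel, ph_zero]

lemma ph_sub (a : Fin 3) (X Y : V) : ph F V a (X - Y) = ph F V a X - ph F V a Y := by
  rw [sub_eq_add_neg, ph_add, ph_neg, sub_eq_add_neg]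

lemma et_eq (a : Fin 3) (X : V) : et F V a X = gm F V X (rxi F V a) := ACM3.eta_eq a X

lemma et_add (a : Fin 3) (X Y : V) : et F V a (X + Y) = et F V a X + et F V a Y := by
  simp only [et_eq, gm_add_left]

lemma et_smul (a : Fin 3) (f : F) (X : V) : et F V a (f • X) = f * et F V a X := by
  simp only [et_eq, gm_smul_left]

lemma et_zero (a : Fin 3) : et F V a (0 : V) = 0 := by
  simpa using et_add F V a 0 0

lemma et_neg (a : Fin 3) (X : V) : et F V a (-X) = -et F V a X := by
  simp only [et_eq, gm_neg_left]

lemma et_sub (a : Fin 3) (X Y : V) : et F V a (X - Y) = et F V a X - et F V a Y := by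
  rw [sub_eq_add_neg, et_add, et_neg, sub_eq_add_neg]

lemma ph_ph (a : Fin 3) (X : V) :
    ph F V a (ph F V a X) = -X + et F V a X • rxi F V a := ACM3.acm_sq a X

lemma et_rxi_self (a : Fin 3) : et F V a (rxi F V a) = 1 := ACM3.eta_xi a

lemma eq_zero_of_smul_rxi {f : F} {a : Fin 3} (h : f • rxi F V a = 0) : f = 0 := by
  have h1 := congrArg (et F V a) h
  rwa [et_smul, et_rxi_self, mul_one, et_zero] at h1

lemma Cyclic.rotate {a b c : Fin 3} (h : Cyclic a b c) : Cyclic b c a := by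
  unfold Cyclic at *
  simp only [Prod.mk.injEq] at *
  tauto

lemma cyclic_add (a : Fin 3) : Cyclic a (a + 1) (a + 2) := by
  fin_cases a <;> simp [Cyclic]

section cyclic

variable {a b c : Fin 3} (h : Cyclic a b c)

include h

lemma ph_rxi_of_cyclic : ph F V a (rxi F V b) = rxi F V c := (ACM3.quat_xi a b c h).symm

lemma ph_rxi_of_cyclic' : ph F V b (rxi F V a) = -rxi F V c :=
  neg_eq_iff_eq_neg.mp (ACM3.quat_xi' a b c h).symm

lemma ph_of_cyclic (X : V) :
    ph F V c X = ph F V a (ph F V b X) - et F V b X • rxi F V a := ACM3.quat_phi a b c h X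

lemma et_of_cyclic (X : V) : et F V c X = et F V a (ph F V b X) := ACM3.quat_eta a b c h X

end cyclic

lemma ph_rxi_self (b : Fin 3) : ph F V b (rxi F V b) = 0 := by
  have h := ((cyclic_add b).rotate).rotate
  have h3 : ph F V b (rxi F V b) = et F V b (ph F V b (rxi F V b)) • rxi F V b := by
    have h0 : ph F V b (ph F V b (rxi F V b)) = 0 := by
      rw [ph_ph, et_rxi_self, one_smul, neg_add_cancel]
    have h1 := ph_ph F V b (ph F V b (rxi F V b))
    rw [h0, ph_zero] at h1
    exact (neg_add_eq_zero.mp h1.symm)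
  have h4 := ph_of_cyclic F V h (rxi F V b)
  rw [ph_rxi_of_cyclic' F V h.rotate, et_rxi_self, one_smul, h3, ph_smul,
    ph_rxi_of_cyclic F V h, eq_sub_iff_add_eq, neg_add_cancel] at h4
  rw [h3, eq_zero_of_smul_rxi F V h4.symm, zero_smul]

lemma et_ph_self (a : Fin 3) (X : V) : et F V a (ph F V a X) = 0 := by
  have h1 := congrArg (ph F V a) (ph_ph F V a X)
  rw [ph_ph, ph_add, ph_neg, ph_smul, ph_rxi_self, smul_zero] at h1
  exact eq_zero_of_smul_rxi F V (add_left_cancel h1)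

lemma gm_ph_left (a : Fin 3) (X Y : V) : gm F V (ph F V a X) Y = -gm F V X (ph F V a Y) := by
  have h : gm F V (ph F V a X) (ph F V a (ph F V a Y))
      = gm F V X (ph F V a Y) - et F V a X * et F V a (ph F V a Y) :=
    ACM3.compat a X (ph F V a Y)
  rw [ph_ph, gm_add_right, gm_neg_right, gm_smul_right, ← et_eq, et_ph_self, et_ph_self] at h
  linear_combination -h

lemma et_rxi_of_cyclic {a b c : Fin 3} (h : Cyclic a b c) : et F V b (rxi F V a) = 0 := by
  rw [et_of_cyclic F V h.rotate.rotate, ph_rxi_self, et_zero]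

lemma et_rxi (a b : Fin 3) : et F V a (rxi F V b) = if a = b then 1 else 0 := by
  have hs : et F V a (rxi F V b) = et F V b (rxi F V a) := by
    rw [et_eq, et_eq, gm_symm]
  have h3 : a = b ∨ b = a + 1 ∨ a = b + 1 := by clear hs; revert a b; decide
  rcases h3 with rfl | rfl | rfl
  · simp [et_rxi_self]
  · rw [hs, et_rxi_of_cyclic F V (cyclic_add a)]
    simp
  · rw [et_rxi_of_cyclic F V (cyclic_add b)]
    simp

lemma der_et_rxi (X : V) (a b : Fin 3) : der F V X (et F V a (rxi F V b)) = 0 := by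
  rw [et_rxi]
  split_ifs
  · exact der_one F V X
  · exact der_zero F V X

lemma horiz_horComp (X : V) : Horiz F V (horComp F V X) := by
  intro a
  fin_cases a <;> simp [horComp, Fin.sum_univ_three, et_sub, et_add, et_smul, et_rxi]

section quasiSasakian

variable {F V}
variable {a b c : Fin 3}

/-- On a normal structure `η` is invariant under the Reeb flow. -/
lemma IsNormal.et_lie (hN : IsNormal F V a) (X : V) :
    et F V a (lie F V (rxi F V a) X) = der F V (rxi F V a) (et F V a X) := by
  have h := congrArg (et F V a) (hN X (rxi F V a))
  rw [NOne, Nij, two_smul_dOne, ph_rxi_self, lie_zero_right, lie_zero_right, ph_zero] at h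
  simp only [et_add, et_sub, et_smul, et_ph_self, et_rxi_self, et_zero, der_one] at h
  rw [lie_antisymm, et_neg] at h
  linear_combination h

/-- On a normal structure `φ` is invariant under the Reeb flow. -/
lemma IsNormal.lie_ph (hN : IsNormal F V a) (X : V) :
    lie F V (rxi F V a) (ph F V a X) = ph F V a (lie F V (rxi F V a) X) := by
  have h := congrArg (ph F V a) (hN X (rxi F V a))
  rw [NOne, Nij, ph_rxi_self, lie_zero_right, lie_zero_right, ph_zero,
    lie_antisymm F V X, lie_antisymm F V (ph F V a X)] at h
  simp only [ph_add, ph_sub, ph_smul, ph_neg, ph_rxi_self, ph_zero, smul_zero, ph_ph,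
    hN.et_lie, et_ph_self, der_zero, zero_smul] at h
  simp only [add_zero, neg_neg, sub_zero] at h
  exact (sub_eq_zero.mp h).symm

/-- The Cartan formula `ℒ_ξ Φ = d i_ξ Φ` for the closed form `Φ_b` and `ξ = ξ_a`. -/
lemma IsClosedTwo.der_gm_ph (hC : IsClosedTwo F V (Phi F V b)) (a : Fin 3) (X Y : V) :
    der F V (rxi F V a) (gm F V X (ph F V b Y))
        - gm F V (lie F V (rxi F V a) X) (ph F V b Y)
        - gm F V X (ph F V b (lie F V (rxi F V a) Y))
      = der F V Y (gm F V X (ph F V b (rxi F V a)))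
        - der F V X (gm F V Y (ph F V b (rxi F V a)))
        + gm F V (lie F V X Y) (ph F V b (rxi F V a)) := by
  have h := congrArg (fun f => (3 : ℝ) • f) (hC (rxi F V a) X Y)
  simp only [dTwo, smul_smul, smul_zero] at h
  rw [mul_inv_cancel₀ three_ne_zero, one_smul] at h
  simp only [Phi] at h
  rw [lie_antisymm F V Y (rxi F V a), gm_neg_left, gm_symm F V (rxi F V a), gm_ph_left,
    der_neg, gm_symm F V (lie F V (rxi F V a) Y), gm_ph_left] at h
  linear_combination h

/-- The Reeb vector field of a quasi-Sasakian structure is Killing. -/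
lemma IsQuasiSasakian.der_gm (hQ : IsQuasiSasakian F V a) (X Y : V) :
    der F V (rxi F V a) (gm F V X Y)
      = gm F V (lie F V (rxi F V a) X) Y + gm F V X (lie F V (rxi F V a) Y) := by
  have h1 := hQ.2.der_gm_ph a X (ph F V a Y)
  simp only [ph_rxi_self, gm_zero_right, der_zero, ← hQ.1.lie_ph, ph_ph, gm_add_right,
    gm_neg_right, gm_smul_right, lie_add_right, lie_neg_right, lie_smul_right, lie_self,
    smul_zero, der_add, der_neg, der_mul, ← et_eq, hQ.1.et_lie, zero_add] at h1
  linear_combination -h1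

end quasiSasakian

section commutingReeb

/-- The Lie derivative `(ℒ_{ξ_a} φ_b) X`. -/
def lieDerivPh (a b : Fin 3) (X : V) : V :=
  lie F V (rxi F V a) (ph F V b X) - ph F V b (lie F V (rxi F V a) X)

lemma lie_ph_eq (a b : Fin 3) (X : V) : lie F V (rxi F V a) (ph F V b X)
    = ph F V b (lie F V (rxi F V a) X) + lieDerivPh F V a b X := by
  rw [lieDerivPh, add_sub_cancel]

variable [ThreeQS F V]

lemma lie_ph_self (a : Fin 3) (X : V) : lie F V (rxi F V a) (ph F V a X)
    = ph F V a (lie F V (rxi F V a) X) := (ThreeQS.qs a).1.lie_ph X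

lemma der_gm_rxi (a : Fin 3) (X Y : V) : der F V (rxi F V a) (gm F V X Y)
      = gm F V (lie F V (rxi F V a) X) Y + gm F V X (lie F V (rxi F V a) Y) :=
  (ThreeQS.qs a).der_gm X Y

variable {F V} {a b c : Fin 3}

/-- `2 dη_c(X, Y) = g(X, (ℒ_{ξ_a} φ_b) Y)`. -/
lemma gm_lieDerivPh (h : Cyclic a b c) (X Y : V) :
    gm F V X (lieDerivPh F V a b Y) = (2 : ℝ) • dOne F V (et F V c) X Y := by
  have h1 := (ThreeQS.qs (F := F) (V := V) b).2.der_gm_ph a X Y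
  rw [ph_rxi_of_cyclic' F V h] at h1
  simp only [gm_neg_right, ← et_eq, der_neg, der_gm_rxi, lie_ph_eq, gm_add_right] at h1
  rw [two_smul_dOne]
  linear_combination h1

/-- `2 dη_c(X, Y) = -g(X, (ℒ_{ξ_b} φ_a) Y)`. -/
lemma gm_lieDerivPh' (h : Cyclic a b c) (X Y : V) :
    gm F V X (lieDerivPh F V b a Y) = -((2 : ℝ) • dOne F V (et F V c) X Y) := by
  have h1 := (ThreeQS.qs (F := F) (V := V) a).2.der_gm_ph b X Y
  rw [ph_rxi_of_cyclic F V h] at h1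
  simp only [← et_eq, der_gm_rxi, lie_ph_eq, gm_add_right] at h1
  rw [two_smul_dOne]
  linear_combination h1

lemma lieDerivPh_swap (h : Cyclic a b c) (X : V) :
    lieDerivPh F V b a X = -lieDerivPh F V a b X :=
  eq_of_gm_eq fun Z => by rw [gm_lieDerivPh' h, gm_neg_right, gm_lieDerivPh h]

variable (hc : cc F V = 0)

include hc

lemma lie_rxi (a b : Fin 3) : lie F V (rxi F V a) (rxi F V b) = 0 := by
  have key : ∀ {a b c : Fin 3}, Cyclic a b c → lie F V (rxi F V a) (rxi F V b) = 0 := by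
    intro a b c h
    have hc' : ThreeQS.c F V = 0 := hc
    rw [ThreeQS.reeb_bracket a b c h, hc', map_zero, zero_smul]
  have h3 : a = b ∨ b = a + 1 ∨ a = b + 1 := by clear hc; revert a b; decide
  rcases h3 with rfl | rfl | rfl
  · exact lie_self F V _
  · exact key (cyclic_add a)
  · rw [lie_antisymm, key (cyclic_add b), neg_zero]

lemma et_lie_rxi (a b : Fin 3) (X : V) :
    et F V b (lie F V (rxi F V a) X) = der F V (rxi F V a) (et F V b X) := by
  rw [et_eq, et_eq, der_gm_rxi, lie_rxi hc, gm_zero_right, add_zero]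

lemma horiz_lieDerivPh (h : Cyclic a b c) (X : V) : Horiz F V (lieDerivPh F V a b X) := by
  intro e
  rw [et_eq, gm_symm, gm_lieDerivPh h, two_smul_dOne, der_et_rxi, et_lie_rxi hc]
  ring

/-- `dη_c` is invariant under the flow of `ξ_e`. -/
lemma lie_lieDerivPh (h : Cyclic a b c) (e : Fin 3) (X : V) :
    lie F V (rxi F V e) (lieDerivPh F V a b X)
      = lieDerivPh F V a b (lie F V (rxi F V e) X) := by
  refine eq_of_gm_eq (F := F) fun Z => ?_
  have h1 := der_gm_rxi F V e Z (lieDerivPh F V a b X)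
  rw [gm_lieDerivPh h, gm_lieDerivPh h, two_smul_dOne, two_smul_dOne] at h1
  rw [gm_lieDerivPh h, two_smul_dOne]
  have h2 := et_lie_rxi hc e c (lie F V Z X)
  rw [lie_lie, et_add] at h2
  simp only [der_sub, der_lie, et_lie_rxi hc] at h1 ⊢
  linear_combination -h1 + h2

lemma ph_lieDerivPh_add (a b : Fin 3) (X : V) :
    ph F V b (lieDerivPh F V a b X) + lieDerivPh F V a b (ph F V b X) = 0 := by
  have h1 := lie_ph_eq F V a b (ph F V b X)
  rw [lie_ph_eq F V a b X, ph_add, ph_ph, ph_ph, lie_add_right, lie_neg_right, lie_smul_right,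
    lie_rxi hc, smul_zero, zero_add, et_lie_rxi hc, add_assoc] at h1
  exact left_eq_add.mp h1

lemma lieDerivPh_lieDerivPh (h : Cyclic a b c) (X : V) :
    lieDerivPh F V a b (lieDerivPh F V a b X) = 0 := by
  have h1 := congrArg (lie F V (rxi F V a)) (ph_lieDerivPh_add hc a b X)
  have hadd : ∀ Y Z : V, lieDerivPh F V a b (Y + Z)
      = lieDerivPh F V a b Y + lieDerivPh F V a b Z := fun Y Z => by
    simp only [lieDerivPh, lie_add_right, ph_add]
    abel
  rw [lie_add_right, lie_ph_eq, lie_lieDerivPh hc h, lie_lieDerivPh hc h, lie_ph_eq, hadd,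
    lie_zero_right] at h1
  refine eq_zero_of_add_self_eq_zero F ?_
  rw [← h1, ← sub_eq_zero, ← neg_eq_zero, ← ph_lieDerivPh_add hc a b (lie F V (rxi F V a) X)]
  abel

lemma lieDerivPh_rotate (h : Cyclic a b c) (X : V) :
    lieDerivPh F V c a X = -ph F V a (lieDerivPh F V a b X) := by
  have h1 := lie_ph_eq F V a c X
  rw [ph_of_cyclic F V h, ph_of_cyclic F V h, lie_sub_right, lie_smul_right, lie_self,
    lie_ph_self, lie_ph_eq, ph_add, et_lie_rxi hc, smul_zero, zero_add] at h1
  rw [← neg_eq_iff_eq_neg, ← lieDerivPh_swap h.rotate.rotate, eq_comm]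
  rw [← sub_eq_zero] at h1 ⊢
  rw [← h1]
  abel

lemma inE4m_lieDerivPh (h : Cyclic a b c) (X : V) : InE4m F V (lieDerivPh F V a b X) := by
  refine ⟨horiz_lieDerivPh hc h X, fun e Y => ?_⟩
  have key : ∀ {a' b' : Fin 3}, Cyclic a' b' e →
      lieDerivPh F V a' b' (lieDerivPh F V a b X) = 0 →
      dOne F V (et F V e) (lieDerivPh F V a b X) Y = 0 := by
    intro a' b' h' h0
    have h1 := gm_lieDerivPh (F := F) h' Y (lieDerivPh F V a b X)
    rw [h0, gm_zero_right, two_smul_dOne] at h1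
    rw [dOne_eq_zero_iff, lie_antisymm, et_neg]
    linear_combination h1
  have hsq := lieDerivPh_lieDerivPh (F := F) hc h X
  have hca := lieDerivPh_rotate (F := F) hc h (lieDerivPh F V a b X)
  rw [hsq, ph_zero, neg_zero] at hca
  have hbc := lieDerivPh_rotate (F := F) hc h.rotate.rotate (lieDerivPh F V a b X)
  rw [hca, ph_zero, neg_zero] at hbc
  have he : e = a ∨ e = b ∨ e = c := by
    unfold Cyclic at h
    simp only [Prod.mk.injEq] at h
    omega
  rcases he with rfl | rfl | rfl
  · exact key h.rotate hbc
  · exact key h.rotate.rotate hca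
  · exact key h hsq

lemma dOne_et_eq_zero (c : Fin 3) (X Y : V) : dOne F V (et F V c) X Y = 0 := by
  have h := (cyclic_add c).rotate
  rw [← smul_eq_zero_iff_right (two_ne_zero (α := ℝ)), ← gm_lieDerivPh h]
  obtain ⟨U, W, hU, hW, hX⟩ := ThreeQS.horiz_split (F := F) _ (horiz_horComp F V X)
  have hA := inE4m_lieDerivPh hc h Y
  have hX' : X = U + W + ∑ e : Fin 3, et F V e X • rxi F V e := by
    rw [← hX, horComp, sub_add_cancel]
  have hv : ∀ e, gm F V (rxi F V e) (lieDerivPh F V (c + 1) (c + 2) Y) = 0 := fun e => by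
    rw [gm_symm, ← et_eq, hA.1 e]
  rw [hX', Fin.sum_univ_three]
  simp only [gm_add_left, gm_smul_left, hv, hU.2 _ hA, gm_lieDerivPh h W, hW.2 c Y]
  simp

end commutingReeb

end lemmas

/-- Every 3-quasi-Sasakian manifold of rank `4l+1` (equivalently,
with `c = 0`, i.e. whose Reeb vector fields pairwise commute) is 3-cosymplectic. -/
theorem rank_4l1_threeCosymplectic (F V : Type) [CommRing F] [Algebra ℝ F] [AddCommGroup V] [Module F V]
    [SmoothSetting F V] [ACM3 F V] [ThreeQS F V]
    (hc : cc F V = 0) :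
    ThreeCosymplectic F V := by
  exact fun a => ⟨(ThreeQS.qs a).1, dOne_et_eq_zero hc a, (ThreeQS.qs a).2⟩

end QS3
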